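/- arXiv:2405.18067 — 2 statements merged into one kernel-verified Lean document; each statement's English description precedes it below -/
import Mathlib

section
/- Let K ⊂ ℝ² be a convex polygon with 0 in its interior, with facet data as in Corollary 1.2, and let c(K ×_L J₂K) denote the Haim–Kislev combinatorial quantity (equal to the Ekeland–Hofer–Zehnder capacity) of the Lagrangian product K ×_L J₂K ⊂ ℝ⁴. Then c(K ×_L J₂K) ≤ √2 · (2! · Vol(K ×_L J₂K))^{1/2}, i.e. the normalized Viterbo ratio c(D)/(n! Vol(D))^{1/n} of the 4-dimensional convex body D = K ×_L J₂K (so n = 2) is at most √2. -/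
open scoped RealInnerProductSpace BigOperators

noncomputable section

/-- `ℝ^m` with the Euclidean inner product. -/
abbrev Es (m : ℕ) := EuclideanSpace ℝ (Fin m)

/-- Doubled facet data: the first copy `f` lives on indices `0,…,N-1`
and the second copy `g` on indices `N,…,2N-1`. -/
def dbl {N : ℕ} {α : Sort _} (f g : Fin N → α) (k : Fin (2 * N)) : α :=
  if hk : (k : ℕ) < N then f ⟨k, hk⟩ else g ⟨(k : ℕ) - N, by omega⟩

/-- The symplectic form on the Lagrangian product `ℝ^{2n} × ℝ^{2n}`:
`ω̃((q,p),(q′,p′)) = ⟪q, p′⟫ − ⟪q′, p⟫`. -/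
def omegaT {m : ℕ} (x y : Es m × Es m) : ℝ := ⟪x.1, y.2⟫ - ⟪y.1, x.2⟫

/-- The Haim–Kislev combinatorial expression for the Ekeland–Hofer–Zehnder capacity of a
convex polytope with facet unit outer normals `m i` and oriented heights `g i` in a
symplectic vector space `(V, ω)`:
`c = (1/2) ⬝ (sup over admissible (β,σ) with Q(β,σ) > 0 of Q(β,σ))⁻¹`, where
`Q(β,σ) = ∑_{j<i} β_{σ(i)} β_{σ(j)} ω(m_{σ(j)}, m_{σ(i)})` and admissibility means
`β i ≥ 0`, `∑ β i * g i = 1`, `∑ β i • m i = 0`. -/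
def combCap {V : Type _} [AddCommGroup V] [Module ℝ V] {L : ℕ}
    (ω : V → V → ℝ) (m : Fin L → V) (g : Fin L → ℝ) : ℝ :=
  (1 / 2 : ℝ) * (sSup {Q : ℝ | ∃ (β : Fin L → ℝ) (σ : Equiv.Perm (Fin L)),
      (∀ i, 0 ≤ β i) ∧ ∑ i, β i * g i = 1 ∧ ∑ i, β i • m i = 0 ∧
      0 < Q ∧ Q = ∑ i, ∑ j ∈ Finset.Iio i, β (σ i) * β (σ j) * ω (m (σ j)) (m (σ i))})⁻¹

/-- A linear functional bounded by `M` on a polytope `{x | ∀ i, ⟪x, n i⟫ ≤ h i}` is a nonnegative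
combination of the normals, with total height at most `M`. -/
theorem exists_nonneg_combination {E ι : Type*} [NormedAddCommGroup E] [InnerProductSpace ℝ E]
    [FiniteDimensional ℝ E] [Fintype ι] (n : ι → E) (h : ι → ℝ) (hpos : ∀ i, 0 < h i)
    (u : E) {M : ℝ} (hM : 0 < M) (hu : ∀ x, (∀ i, ⟪x, n i⟫ ≤ h i) → ⟪x, u⟫ ≤ M) :
    ∃ β : ι → ℝ, (∀ i, 0 ≤ β i) ∧ ∑ i, β i • n i = u ∧ ∑ i, β i * h i ≤ M := by
  classical
  let P : Set (ι → ℝ) := {β | (∀ i, 0 ≤ β i) ∧ ∑ i, β i * h i ≤ M}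
  let φ : (ι → ℝ) →ₗ[ℝ] E := Fintype.linearCombination ℝ n
  have hφ : ∀ β, φ β = ∑ i, β i • n i := fun β => Fintype.linearCombination_apply ℝ n β
  have hPconv : Convex ℝ P := by
    rintro β ⟨hβ, hβ'⟩ γ ⟨hγ, hγ'⟩ a b ha hb hab
    refine ⟨fun i => ?_, ?_⟩
    · have := mul_nonneg ha (hβ i)
      have := mul_nonneg hb (hγ i)
      simp only [Pi.add_apply, Pi.smul_apply, smul_eq_mul]
      linarith
    · have : ∑ i, (a • β + b • γ) i * h i = a * ∑ i, β i * h i + b * ∑ i, γ i * h i := by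
        simp only [Pi.add_apply, Pi.smul_apply, smul_eq_mul, Finset.mul_sum,
          ← Finset.sum_add_distrib]
        exact Finset.sum_congr rfl fun i _ => by ring
      rw [this]
      have h1 := mul_le_mul_of_nonneg_left hβ' ha
      have h2 := mul_le_mul_of_nonneg_left hγ' hb
      have : a * M + b * M = M := by rw [← add_mul, hab, one_mul]
      linarith
  have hPcpt : IsCompact P := by
    refine (isCompact_Icc (a := (0 : ι → ℝ)) (b := fun i => M / h i)).of_isClosed_subset ?_ ?_
    · have : P = (⋂ i, {β | 0 ≤ β i}) ∩ {β | ∑ i, β i * h i ≤ M} := by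
        ext β; simp [P]
      rw [this]
      exact (isClosed_iInter fun i => isClosed_le continuous_const (continuous_apply i)).inter
        (isClosed_le (by fun_prop) continuous_const)
    · rintro β ⟨hβ, hβ'⟩
      refine ⟨hβ, fun i => (le_div_iff₀ (hpos i)).2 (le_trans ?_ hβ')⟩
      exact Finset.single_le_sum (f := fun i => β i * h i)
        (fun j _ => mul_nonneg (hβ j) (hpos j).le) (Finset.mem_univ i)
  by_contra hcon
  have hnot : u ∉ φ '' P := by
    rintro ⟨β, ⟨h1, h2⟩, h3⟩
    exact hcon ⟨β, h1, by rw [← hφ, h3], h2⟩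
  obtain ⟨f, s, hfs, hsu⟩ := geometric_hahn_banach_closed_point (hPconv.linear_image φ)
    (hPcpt.image φ.continuous_of_finiteDimensional).isClosed hnot
  have hs : 0 < s := by
    simpa using hfs 0 ⟨0, ⟨fun i => le_rfl, by simpa using hM.le⟩, map_zero φ⟩
  let y := (InnerProductSpace.toDual ℝ E).symm f
  have hy : ∀ x, ⟪y, x⟫ = f x := fun x => InnerProductSpace.toDual_symm_apply
  have hK : ∀ i, ⟪(M / s) • y, n i⟫ ≤ h i := by
    intro i
    have h1 := hfs (φ (Pi.single i (M / h i))) ⟨_, ⟨?_, ?_⟩, rfl⟩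
    · have h2 : φ (Pi.single i (M / h i)) = (M / h i) • n i :=
        Fintype.linearCombination_apply_single ℝ n i _
      rw [h2, map_smul, smul_eq_mul, div_mul_eq_mul_div, div_lt_iff₀ (hpos i)] at h1
      rw [real_inner_smul_left, hy, div_mul_eq_mul_div, div_le_iff₀ hs]
      linarith
    · intro j
      exact (Pi.single_nonneg.2 (div_pos hM (hpos i)).le : (0 : ι → ℝ) ≤ _) j
    · rw [Finset.sum_eq_single i (fun j _ hj => by simp [hj]) (by simp)]
      simp [(hpos i).ne']
  have h1 := hu _ hK
  rw [real_inner_smul_left, hy, div_mul_eq_mul_div, div_le_iff₀ hs] at h1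
  exact absurd (lt_of_mul_lt_mul_left (lt_of_le_of_lt h1 (mul_lt_mul_of_pos_left hsu hM)) hM.le)
    (lt_irrefl _)

/-- Sorting the indices by a key `k`: if `F` vanishes on pairs with equal keys, the sum of `F` over
pairs ordered by some permutation is the sum over the pairs ordered by `k`. -/
theorem exists_perm_sum_Iio_eq {L : ℕ} (k : Fin L → ℕ) (F : Fin L → Fin L → ℝ)
    (hF : ∀ a b, k a = k b → F a b = 0) :
    ∃ σ : Equiv.Perm (Fin L), ∑ i, ∑ j ∈ Finset.Iio i, F (σ i) (σ j) =
      ∑ a, ∑ b, if k b < k a then F a b else 0 := by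
  refine ⟨Tuple.sort k, ?_⟩
  have hmono := Tuple.monotone_sort k
  refine Eq.trans ?_ (Equiv.sum_comp (Tuple.sort k) _)
  refine Finset.sum_congr rfl fun i _ => ?_
  refine Eq.trans ?_ (Equiv.sum_comp (Tuple.sort k) _)
  rw [← Finset.sum_filter_add_sum_filter_not Finset.univ (· < i)]
  have h0 : (Finset.univ.filter (· < i)) = Finset.Iio i := by ext; simp
  rw [h0, Finset.sum_eq_zero (s := Finset.univ.filter (¬ · < i)), add_zero]
  · refine Finset.sum_congr rfl fun j hj => ?_
    have : k (Tuple.sort k j) ≤ k (Tuple.sort k i) := hmono (Finset.mem_Iio.1 hj).le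
    split_ifs with hlt
    · rfl
    · exact hF _ _ (by omega)
  · intro j hj
    have : k (Tuple.sort k i) ≤ k (Tuple.sort k j) := hmono (by simpa using hj)
    rw [if_neg (by omega)]

theorem sum_fin_two_mul {M : Type*} [AddCommMonoid M] {N : ℕ} (F : Fin (2 * N) → M) :
    ∑ k, F k = ∑ i : Fin N, F ⟨i, by omega⟩ + ∑ i : Fin N, F ⟨N + i, by omega⟩ := by
  rw [← Equiv.sum_comp (finCongr (two_mul N).symm) F, Fin.sum_univ_add]
  rfl

theorem dbl_left {N : ℕ} {α : Sort*} (f g : Fin N → α) (i : Fin N) (hi : (i : ℕ) < 2 * N) :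
    dbl f g ⟨i, hi⟩ = f i := by
  simp [dbl]

theorem dbl_right {N : ℕ} {α : Sort*} (f g : Fin N → α) (i : Fin N) (hi : N + (i : ℕ) < 2 * N) :
    dbl f g ⟨N + i, hi⟩ = g i := by
  simp [dbl]

theorem exists_of_fin_two_mul {N : ℕ} (a : Fin (2 * N)) :
    (∃ i : Fin N, a = ⟨i, by omega⟩) ∨ ∃ i : Fin N, a = ⟨N + i, by omega⟩ := by
  by_cases ha : (a : ℕ) < N
  · exact Or.inl ⟨⟨a, ha⟩, rfl⟩
  · exact Or.inr ⟨⟨a - N, by omega⟩, Fin.ext (by simp; omega)⟩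

/-- Let the weights `x` annihilate the array `B` on the left. If `x`-indices and `y`-indices are
ordered in the blocks `S`, `T`, `Sᶜ`, `Tᶜ`, the signed sum reduces to twice the sum over `S × T`. -/
theorem sum_blocks_eq {ι : Type*} [Fintype ι] [DecidableEq ι] (x y : ι → ℝ) (B : ι → ι → ℝ)
    (hB : ∀ j, ∑ i, x i * B i j = 0) (S T : Finset ι) :
    ∑ i, ∑ j, x i * y j * B i j *
        (1 - 2 * (if j ∈ T then 1 else 0) + 2 * (if i ∈ S then if j ∈ T then 1 else 0 else 0)) =
      2 * ∑ i ∈ S, ∑ j ∈ T, x i * y j * B i j := by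
  have h1 : ∑ i, ∑ j, x i * y j * B i j * (1 - 2 * (if j ∈ T then 1 else 0)) = 0 := by
    rw [Finset.sum_comm]
    refine Finset.sum_eq_zero fun j _ => ?_
    have : ∑ i, x i * y j * B i j * (1 - 2 * (if j ∈ T then 1 else 0)) =
        (y j * (1 - 2 * (if j ∈ T then 1 else 0))) * ∑ i, x i * B i j := by
      rw [Finset.mul_sum]
      exact Finset.sum_congr rfl fun i _ => by ring
    rw [this, hB, mul_zero]
  have h2 : ∑ i ∈ S, ∑ j ∈ T, x i * y j * B i j =
      ∑ i, ∑ j, x i * y j * B i j * (if i ∈ S then if j ∈ T then 1 else 0 else 0) := by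
    have e := Finset.sum_ite_mem Finset.univ S fun i => ∑ j ∈ T, x i * y j * B i j
    rw [Finset.univ_inter] at e
    rw [← e]
    refine Finset.sum_congr rfl fun i _ => ?_
    split_ifs
    · simp [mul_ite, Finset.sum_ite_mem]
    · simp
  simp only [mul_add, Finset.sum_add_distrib, h1, zero_add, h2, Finset.mul_sum]
  exact Finset.sum_congr rfl fun i _ => Finset.sum_congr rfl fun j _ => by
    rw [mul_left_comm]

/-- Bound for the combinatorial capacity of a Lagrangian product from a four-block ordering. -/
theorem combCap_dbl_le {m N : ℕ} (a b : Fin N → Es m) (h g β γ : Fin N → ℝ)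
    (hβ : ∀ i, 0 ≤ β i) (hγ : ∀ i, 0 ≤ γ i) (hβ0 : ∑ i, β i • a i = 0)
    (hγ0 : ∑ i, γ i • b i = 0) (hA : 0 < ∑ i, β i * h i) (hB : 0 < ∑ i, γ i * g i)
    (S T : Finset (Fin N)) (hq : 0 < ∑ i ∈ S, ∑ j ∈ T, β i * γ j * ⟪a i, b j⟫) :
    combCap omegaT (dbl (fun i => (a i, (0 : Es m))) (fun i => ((0 : Es m), b i))) (dbl h g) ≤
      (∑ i, β i * h i) * (∑ i, γ i * g i) / ∑ i ∈ S, ∑ j ∈ T, β i * γ j * ⟪a i, b j⟫ := by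
  set A := ∑ i, β i * h i with hAdef
  set B := ∑ i, γ i * g i with hBdef
  set q := ∑ i ∈ S, ∑ j ∈ T, β i * γ j * ⟪a i, b j⟫ with hqdef
  set w : Fin (2 * N) → ℝ := dbl (fun i => β i / (2 * A)) (fun i => γ i / (2 * B)) with hw
  set n : Fin (2 * N) → Es m × Es m :=
    dbl (fun i => (a i, (0 : Es m))) (fun i => ((0 : Es m), b i)) with hn
  let k : Fin (2 * N) → ℕ :=
    dbl (fun i => if i ∈ S then 0 else 2) (fun j => if j ∈ T then 1 else 3)
  obtain ⟨σ, hσ⟩ := exists_perm_sum_Iio_eq k (fun i j => w i * w j * omegaT (n j) (n i)) (by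
    intro i j hij
    obtain ⟨i, rfl⟩ | ⟨i, rfl⟩ := exists_of_fin_two_mul i <;>
    obtain ⟨j, rfl⟩ | ⟨j, rfl⟩ := exists_of_fin_two_mul j <;>
    simp only [k, dbl_left, dbl_right] at hij
    · simp [hn, dbl_left, omegaT]
    · split_ifs at hij <;> omega
    · split_ifs at hij <;> omega
    · simp [hn, dbl_right, omegaT])
  have hQ : ∑ i, ∑ j, (if k j < k i then w i * w j * omegaT (n j) (n i) else 0) =
      2 * q / (2 * A * (2 * B)) := by
    have hx : ∀ j, ∑ i, (β i / (2 * A)) * ⟪a i, b j⟫ = 0 := by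
      intro j
      have : ⟪∑ i, β i • a i, b j⟫ = 0 := by rw [hβ0, inner_zero_left]
      rw [sum_inner] at this
      simp only [real_inner_smul_left] at this
      simp_rw [div_mul_eq_mul_div]
      rw [← Finset.sum_div, this, zero_div]
    have key := sum_blocks_eq (fun i => β i / (2 * A)) (fun i => γ i / (2 * B))
      (fun i j => ⟪a i, b j⟫) hx S T
    have hrhs : 2 * ∑ i ∈ S, ∑ j ∈ T, β i / (2 * A) * (γ j / (2 * B)) * ⟪a i, b j⟫ =
        2 * q / (2 * A * (2 * B)) := by
      rw [hqdef, mul_div_assoc, Finset.sum_div]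
      congr 1
      refine Finset.sum_congr rfl fun i _ => ?_
      rw [Finset.sum_div]
      exact Finset.sum_congr rfl fun j _ => by ring
    rw [← hrhs, ← key]
    simp only [sum_fin_two_mul, hw, hn, k, dbl_left, dbl_right, omegaT, inner_zero_left,
      inner_zero_right, sub_zero, zero_sub, neg_zero, mul_zero, ite_self, Finset.sum_const_zero,
      add_zero, zero_add]
    rw [Finset.sum_comm (s := Finset.univ (α := Fin N)), ← Finset.sum_add_distrib, Finset.sum_comm]
    simp only [← Finset.sum_add_distrib]
    refine Finset.sum_congr rfl fun i _ => Finset.sum_congr rfl fun j _ => ?_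
    split_ifs <;> first | omega | ring
  have hmem : 2 * q / (2 * A * (2 * B)) ∈ {Q : ℝ | ∃ (β : Fin (2 * N) → ℝ)
      (σ : Equiv.Perm (Fin (2 * N))), (∀ i, 0 ≤ β i) ∧ ∑ i, β i * dbl h g i = 1 ∧
      ∑ i, β i • n i = 0 ∧ 0 < Q ∧
      Q = ∑ i, ∑ j ∈ Finset.Iio i, β (σ i) * β (σ j) * omegaT (n (σ j)) (n (σ i))} := by
    refine ⟨w, σ, ?_, ?_, ?_, by positivity, (hσ.trans hQ).symm⟩
    · intro i
      obtain ⟨i, rfl⟩ | ⟨i, rfl⟩ := exists_of_fin_two_mul i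
      · simpa only [hw, dbl_left] using div_nonneg (hβ i) (by positivity)
      · simpa only [hw, dbl_right] using div_nonneg (hγ i) (by positivity)
    · simp only [sum_fin_two_mul, hw, dbl_left, dbl_right, div_mul_eq_mul_div]
      rw [← Finset.sum_div, ← Finset.sum_div, ← hAdef, ← hBdef]
      field_simp
      exact one_add_one_eq_two
    · simp only [sum_fin_two_mul, hw, hn, dbl_left, dbl_right, Prod.smul_mk, smul_zero]
      have h1 : ∑ i, (β i / (2 * A)) • a i = 0 := by
        simp_rw [div_eq_inv_mul, mul_smul]
        rw [← Finset.smul_sum, hβ0, smul_zero]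
      have h2 : ∑ i, (γ i / (2 * B)) • b i = 0 := by
        simp_rw [div_eq_inv_mul, mul_smul]
        rw [← Finset.smul_sum, hγ0, smul_zero]
      ext1 <;> simp [Prod.fst_sum, Prod.snd_sum, h1, h2]
  unfold combCap
  by_cases hbdd : BddAbove {Q : ℝ | ∃ (β : Fin (2 * N) → ℝ)
      (σ : Equiv.Perm (Fin (2 * N))), (∀ i, 0 ≤ β i) ∧ ∑ i, β i * dbl h g i = 1 ∧
      ∑ i, β i • n i = 0 ∧ 0 < Q ∧
      Q = ∑ i, ∑ j ∈ Finset.Iio i, β (σ i) * β (σ j) * omegaT (n (σ j)) (n (σ i))}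
  · have hle := inv_anti₀ (by positivity) (le_csSup hbdd hmem)
    have : A * B / q = 1 / 2 * (2 * q / (2 * A * (2 * B)))⁻¹ := by
      field_simp
    rw [this]
    exact mul_le_mul_of_nonneg_left hle (by norm_num)
  · rw [Real.sSup_of_not_bddAbove hbdd]
    simp only [inv_zero, mul_zero]
    positivity

/-- Twice the area of a triangle with vertices in `ℝ²` is at least the determinant of its sides. -/
theorem ofReal_abs_det_le_two_mul_volume_convexHull (p q r : Es 2) :
    ENNReal.ofReal |(q - p) 0 * (r - p) 1 - (q - p) 1 * (r - p) 0| ≤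
      2 * MeasureTheory.volume (convexHull ℝ {p, q, r}) := by
  set T := convexHull ℝ {p, q, r}
  have hp : p ∈ T := subset_convexHull _ _ (by simp)
  have hq : q ∈ T := subset_convexHull _ _ (by simp)
  have hr : r ∈ T := subset_convexHull _ _ (by simp)
  have hconv : Convex ℝ T := convex_convexHull _ _
  have hcomb : ∀ s t : ℝ, 0 ≤ s → 0 ≤ t → s + t ≤ 1 → p + s • (q - p) + t • (r - p) ∈ T := by
    intro s t hs ht hst
    have := hconv.sum_mem (t := Finset.univ) (w := ![1 - s - t, s, t]) (z := ![p, q, r])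
      (by intro i _; fin_cases i <;> simp <;> linarith)
      (by simp [Fin.sum_univ_three]; ring)
      (by intro i _; fin_cases i <;> simpa)
    convert this using 1
    simp only [Fin.sum_univ_three, Matrix.cons_val]
    module
  have hvol : MeasureTheory.volume (parallelepiped ![q - p, r - p]) =
      ENNReal.ofReal |(q - p) 0 * (r - p) 1 - (q - p) 1 * (r - p) 0| := by
    have hb := (EuclideanSpace.basisFun (Fin 2) ℝ).addHaar_eq_volume
    rw [← hb, MeasureTheory.Measure.addHaar_parallelepiped, Module.Basis.det_apply,
      Matrix.det_fin_two]
    simp [Module.Basis.toMatrix_apply]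
    ring_nf
  have hsub : parallelepiped ![q - p, r - p] ⊆
      ((fun x => x + p) ⁻¹' T) ∪ ((fun x => r + q - p + -x) ⁻¹' T) := by
    intro x hx
    rw [mem_parallelepiped_iff] at hx
    obtain ⟨t, ⟨h0, h1⟩, rfl⟩ := hx
    have h00 := h0 0
    have h01 := h0 1
    have h10 := h1 0
    have h11 := h1 1
    simp only [Pi.zero_apply, Pi.one_apply] at h00 h01 h10 h11
    simp only [Fin.sum_univ_two, Matrix.cons_val]
    rcases le_total (t 0 + t 1) 1 with hle | hle
    · left
      rw [Set.mem_preimage]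
      convert hcomb _ _ h00 h01 hle using 1
      module
    · right
      rw [Set.mem_preimage]
      convert hcomb (1 - t 0) (1 - t 1) (by linarith) (by linarith) (by linarith) using 1
      module
  have h1 : MeasureTheory.volume ((fun x => x + p) ⁻¹' T) = MeasureTheory.volume T :=
    MeasureTheory.measure_preimage_add_right _ _ _
  have h2 : MeasureTheory.volume ((fun x => r + q - p + -x) ⁻¹' T) = MeasureTheory.volume T :=
    (MeasureTheory.Measure.measure_preimage_neg _ ((fun x => r + q - p + x) ⁻¹' T)).trans
      (MeasureTheory.measure_preimage_add _ _ _)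
  rw [← hvol, two_mul]
  refine (MeasureTheory.measure_mono hsub).trans ((MeasureTheory.measure_union_le _ _).trans ?_)
  rw [h1, h2]

/-- A convex planar region containing `p`, `q` and points `r`, `s` on the two sides of the line
through `p` and `q` has at least the area of the quadrilateral `prqs`. -/
theorem le_two_mul_volume_of_mem (K : Set (Es 2)) (hK : Convex ℝ K) (hKm : IsCompact K)
    (w : Es 2) (hw : w ≠ 0) {p q r s : Es 2} (hp : p ∈ K) (hq : q ∈ K) (hr : r ∈ K) (hs : s ∈ K)
    (hqw : ⟪q, w⟫ = ⟪p, w⟫) (hrw : ⟪p, w⟫ ≤ ⟪r, w⟫) (hsw : ⟪s, w⟫ ≤ ⟪p, w⟫)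
    (hdet : ∀ x, (q - p) 0 * x 1 - (q - p) 1 * x 0 = ⟪x, w⟫) :
    ⟪r - s, w⟫ ≤ 2 * (MeasureTheory.volume K).toReal := by
  have hlin : IsLinearMap ℝ fun x : Es 2 => ⟪x, w⟫ :=
    ⟨fun x y => inner_add_left x y w, fun c x => real_inner_smul_left x w c⟩
  have hT1 : convexHull ℝ {p, q, r} ⊆ K ∩ {x | ⟪p, w⟫ ≤ ⟪x, w⟫} := by
    refine convexHull_min ?_ (hK.inter (convex_halfSpace_ge hlin _))
    rintro x (rfl | rfl | rfl)
    exacts [⟨hp, le_refl ⟪_, w⟫⟩, ⟨hq, hqw.ge⟩, ⟨hr, hrw⟩]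
  have hT2 : convexHull ℝ {p, q, s} ⊆ K ∩ {x | ⟪x, w⟫ ≤ ⟪p, w⟫} := by
    refine convexHull_min ?_ (hK.inter (convex_halfSpace_le hlin _))
    rintro x (rfl | rfl | rfl)
    exacts [⟨hp, le_refl ⟪_, w⟫⟩, ⟨hq, hqw.le⟩, ⟨hs, hsw⟩]
  have h1 := (ofReal_abs_det_le_two_mul_volume_convexHull p q r).trans
    (mul_le_mul_right (MeasureTheory.measure_mono hT1) 2)
  have h2 := (ofReal_abs_det_le_two_mul_volume_convexHull p q s).trans
    (mul_le_mul_right (MeasureTheory.measure_mono hT2) 2)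
  have hnull : MeasureTheory.volume ({x : Es 2 | ⟪x, w⟫ = ⟪p, w⟫}) = 0 := by
    have h0 : MeasureTheory.volume ((innerₛₗ ℝ w).ker : Set (Es 2)) = 0 := by
      refine MeasureTheory.Measure.addHaar_submodule _ _ fun htop => hw ?_
      have : w ∈ (innerₛₗ ℝ w).ker := htop ▸ Submodule.mem_top
      simpa using this
    rw [← h0, ← MeasureTheory.measure_preimage_add_right MeasureTheory.volume p]
    congr 1
    ext x
    simp [inner_add_right, real_inner_comm]
  have hunion : MeasureTheory.volume (K ∩ {x | ⟪p, w⟫ ≤ ⟪x, w⟫}) +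
      MeasureTheory.volume (K ∩ {x | ⟪x, w⟫ ≤ ⟪p, w⟫}) ≤ MeasureTheory.volume K := by
    rw [← MeasureTheory.measure_union₀
      (hKm.measurableSet.inter (isClosed_le (by fun_prop) (by fun_prop)).measurableSet
        |>.nullMeasurableSet)]
    · exact MeasureTheory.measure_mono (Set.union_subset Set.inter_subset_left Set.inter_subset_left)
    · refine MeasureTheory.measure_mono_null ?_ hnull
      rintro x ⟨⟨_, h1⟩, ⟨_, h2⟩⟩
      exact le_antisymm h2 h1
  have htop : MeasureTheory.volume K ≠ ⊤ := hKm.measure_lt_top.ne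
  have h3 := (add_le_add h1 h2).trans_eq (mul_add _ _ _).symm |>.trans
    (mul_le_mul_right hunion 2)
  rw [← ENNReal.ofReal_add (abs_nonneg _) (abs_nonneg _), hdet, hdet] at h3
  have h4 := ENNReal.toReal_mono (ENNReal.mul_ne_top (by simp) htop) h3
  rw [ENNReal.toReal_ofReal (by positivity), ENNReal.toReal_mul] at h4
  simp only [inner_sub_left, ENNReal.toReal_ofNat] at h4 ⊢
  have := le_abs_self (⟪r, w⟫ - ⟪p, w⟫)
  have := neg_le_abs (⟪s, w⟫ - ⟪p, w⟫)
  linarith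

/-- Restricting to the indices where `v` is positive can only increase a nonnegative combination,
even after enlarging the weights. -/
theorem sum_mul_le_sum_filter_pos {ι : Type*} [Fintype ι] (β₁ β v : ι → ℝ) (h0 : ∀ i, 0 ≤ β₁ i)
    (hle : ∀ i, β₁ i ≤ β i) :
    ∑ i, β₁ i * v i ≤ ∑ i with 0 < v i, β i * v i := by
  rw [Finset.sum_filter]
  refine Finset.sum_le_sum fun i _ => ?_
  split_ifs with hv
  · exact mul_le_mul_of_nonneg_right (hle i) hv.le
  · exact mul_nonpos_of_nonneg_of_nonpos (h0 i) (not_lt.1 hv)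

theorem exists_finset_sum_mul_le {ι κ : Type*} [Fintype ι] [Fintype κ] (β₁ β : ι → ℝ)
    (γ₁ γ : κ → ℝ) (B : ι → κ → ℝ) (hβ0 : ∀ i, 0 ≤ β₁ i) (hβ : ∀ i, β₁ i ≤ β i)
    (hγ0 : ∀ i, 0 ≤ γ₁ i) (hγ : ∀ i, γ₁ i ≤ γ i) :
    ∃ (S : Finset ι) (T : Finset κ),
      ∑ i, ∑ j, β₁ i * γ₁ j * B i j ≤ ∑ i ∈ S, ∑ j ∈ T, β i * γ j * B i j := by
  set T : Finset κ := {j | 0 < ∑ i, β₁ i * B i j}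
  refine ⟨({i | 0 < ∑ j ∈ T, γ j * B i j} : Finset ι), T, ?_⟩
  calc ∑ i, ∑ j, β₁ i * γ₁ j * B i j = ∑ j, γ₁ j * ∑ i, β₁ i * B i j := by
        rw [Finset.sum_comm]
        simp only [Finset.mul_sum]
        exact Finset.sum_congr rfl fun j _ => Finset.sum_congr rfl fun i _ => by ring
    _ ≤ ∑ j ∈ T, γ j * ∑ i, β₁ i * B i j := sum_mul_le_sum_filter_pos _ _ _ hγ0 hγ
    _ = ∑ i, β₁ i * ∑ j ∈ T, γ j * B i j := by
        simp only [Finset.mul_sum]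
        rw [Finset.sum_comm]
        exact Finset.sum_congr rfl fun j _ => Finset.sum_congr rfl fun i _ => by ring
    _ ≤ ∑ i with 0 < ∑ j ∈ T, γ j * B i j, β i * ∑ j ∈ T, γ j * B i j :=
        sum_mul_le_sum_filter_pos _ _ _ hβ0 hβ
    _ = _ := by
        simp only [Finset.mul_sum, mul_assoc]

/-- The width of a polytope in direction `u`, realised by weights on its normals: `β` is balanced
and dominates a combination `β₁` representing `u`. -/
theorem exists_balanced_weights {E ι : Type*} [NormedAddCommGroup E] [InnerProductSpace ℝ E]
    [FiniteDimensional ℝ E] [Fintype ι] (n : ι → E) (h : ι → ℝ) (hpos : ∀ i, 0 < h i)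
    (u p q : E) (hp : ∀ x, (∀ i, ⟪x, n i⟫ ≤ h i) → ⟪p, u⟫ ≤ ⟪x, u⟫)
    (hq : ∀ x, (∀ i, ⟪x, n i⟫ ≤ h i) → ⟪x, u⟫ ≤ ⟪q, u⟫) (hqK : ∀ i, ⟪q, n i⟫ ≤ h i)
    (hp0 : ⟪p, u⟫ < 0) (hq0 : 0 < ⟪q, u⟫) :
    ∃ β₁ β : ι → ℝ, (∀ i, 0 ≤ β₁ i) ∧ (∀ i, β₁ i ≤ β i) ∧ ∑ i, β₁ i • n i = u ∧
      ∑ i, β i • n i = 0 ∧ 0 < ∑ i, β i * h i ∧ ∑ i, β i * h i ≤ ⟪q - p, u⟫ := by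
  obtain ⟨β₁, h1, h1u, h1h⟩ := exists_nonneg_combination n h hpos u hq0 hq
  obtain ⟨β₂, h2, h2u, h2h⟩ := exists_nonneg_combination n h hpos (-u) (neg_pos.2 hp0)
    fun x hx => by rw [inner_neg_right]; exact neg_le_neg (hp x hx)
  have hqle : ⟪q, u⟫ ≤ ∑ i, β₁ i * h i := by
    rw [← h1u, inner_sum]
    refine Finset.sum_le_sum fun i _ => ?_
    rw [real_inner_smul_right]
    exact mul_le_mul_of_nonneg_left (hqK i) (h1 i)
  have h2nonneg : 0 ≤ ∑ i, β₂ i * h i :=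
    Finset.sum_nonneg fun i _ => mul_nonneg (h2 i) (hpos i).le
  refine ⟨β₁, fun i => β₁ i + β₂ i, h1, fun i => by linarith [h2 i], h1u, ?_, ?_, ?_⟩
  · simp only [add_smul, Finset.sum_add_distrib, h1u, h2u, add_neg_cancel]
  · simp only [add_mul, Finset.sum_add_distrib]
    linarith
  · simp only [add_mul, Finset.sum_add_distrib, inner_sub_left]
    linarith

theorem exists_smul_mem_of_zero_mem_interior {E : Type*} [NormedAddCommGroup E] [NormedSpace ℝ E]
    {K : Set E} (h0 : 0 ∈ interior K) (u : E) : ∃ c : ℝ, 0 < c ∧ c • u ∈ K := by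
  have hcont : Filter.Tendsto (fun c : ℝ => c • u) (nhdsWithin 0 (Set.Ioi 0)) (nhds 0) := by
    have : Continuous fun c : ℝ => c • u := by fun_prop
    simpa using (this.tendsto 0).mono_left nhdsWithin_le_nhds
  have h1 := hcont.eventually (mem_interior_iff_mem_nhds.1 h0)
  obtain ⟨c, hc, hc0⟩ := (h1.and self_mem_nhdsWithin).exists
  exact ⟨c, hc0, hc⟩

theorem exists_mem_inner_pos {E : Type*} [NormedAddCommGroup E] [InnerProductSpace ℝ E]
    {K : Set E} (h0 : 0 ∈ interior K) {u : E} (hu : u ≠ 0) : ∃ x ∈ K, 0 < ⟪x, u⟫ := by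
  obtain ⟨c, hc, hcK⟩ := exists_smul_mem_of_zero_mem_interior h0 u
  refine ⟨c • u, hcK, ?_⟩
  rw [real_inner_smul_left]
  exact mul_pos hc (real_inner_self_pos.2 hu)

theorem exists_mem_inner_neg {E : Type*} [NormedAddCommGroup E] [InnerProductSpace ℝ E]
    {K : Set E} (h0 : 0 ∈ interior K) {u : E} (hu : u ≠ 0) : ∃ x ∈ K, ⟪x, u⟫ < 0 := by
  obtain ⟨x, hx, hpos⟩ := exists_mem_inner_pos h0 (neg_ne_zero.2 hu)
  exact ⟨x, hx, by rwa [inner_neg_right, neg_pos] at hpos⟩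

/-- An endpoint `p` of a diameter `pq` maximises the functional in its direction. -/
theorem inner_le_of_norm_sub_le {E : Type*} [NormedAddCommGroup E] [InnerProductSpace ℝ E]
    {p q x : E} (h : ‖x - q‖ ≤ ‖p - q‖) : ⟪x, p - q⟫ ≤ ⟪p, p - q⟫ := by
  have h1 : ‖x - q‖ ^ 2 ≤ ‖p - q‖ ^ 2 := pow_le_pow_left₀ (norm_nonneg _) h 2
  have h2 : x - q = (p - q) - (p - x) := by abel
  rw [h2, norm_sub_sq_real, real_inner_comm, inner_sub_left] at h1
  nlinarith [sq_nonneg ‖p - x‖]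

theorem volume_prod_image_rotation (J : Es 2 →ₗ[ℝ] Es 2)
    (hJ : ∀ x : Es 2, J x 0 = -(x 1) ∧ J x 1 = x 0) (K : Set (Es 2)) :
    MeasureTheory.volume (K ×ˢ (⇑J '' K)) =
      MeasureTheory.volume K * MeasureTheory.volume K := by
  have hJJ : J * J = -1 := by
    ext x i
    fin_cases i <;> simp [hJ]
  have hdet : LinearMap.det J * LinearMap.det J = 1 := by
    rw [← map_mul, hJJ, ← neg_one_smul ℝ (1 : Es 2 →ₗ[ℝ] Es 2), LinearMap.det_smul]
    simp
  have habs : |LinearMap.det J| = 1 :=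
    (abs_eq zero_le_one).2 (mul_self_eq_one_iff.1 hdet)
  rw [MeasureTheory.Measure.volume_eq_prod, MeasureTheory.Measure.prod_prod,
    MeasureTheory.Measure.addHaar_image_linearMap, habs, ENNReal.ofReal_one, one_mul]

theorem viterbo_ratio_prod_J2K_le_sqrt_two (N : ℕ)
    (J : Es 2 →ₗ[ℝ] Es 2)
    (hJ : ∀ x : Es 2, J x 0 = -(x 1) ∧ J x 1 = x 0)
    (nv : Fin N → Es 2) (hunit : ∀ i, ‖nv i‖ = 1)
    (h : Fin N → ℝ) (hpos : ∀ i, 0 < h i)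
    (K : Set (Es 2))
    (hK : K = {x | ∀ i, ⟪x, nv i⟫ ≤ h i})
    (hKcpt : IsCompact K) (h0 : 0 ∈ interior K) :
    combCap omegaT
        (dbl (fun i => (nv i, (0 : Es 2))) (fun i => ((0 : Es 2), J (nv i))))
        (dbl h h)
      ≤ Real.sqrt 2 *
          Real.sqrt ((Nat.factorial 2 : ℝ) *
            (MeasureTheory.volume (K ×ˢ (⇑J '' K))).toReal) := by
  have hmemK : ∀ x, x ∈ K ↔ ∀ i, ⟪x, nv i⟫ ≤ h i := fun x => by rw [hK]; rfl
  have hconv : Convex ℝ K := by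
    have : K = ⋂ i, {x | ⟪x, nv i⟫ ≤ h i} := by
      rw [hK]
      ext x
      simp
    rw [this]
    exact convex_iInter fun i => convex_halfSpace_le
      ⟨fun x y => inner_add_left x y _, fun c x => real_inner_smul_left x _ c⟩ _
  have hne : K.Nonempty := ⟨0, interior_subset h0⟩
  have hinner : ∀ x y : Es 2, ⟪x, y⟫ = x 0 * y 0 + x 1 * y 1 := fun x y => by
    simp [PiLp.inner_apply, Fin.sum_univ_two, mul_comm]
  obtain ⟨⟨p, q⟩, ⟨hp, hq⟩, hmax⟩ := (hKcpt.prod hKcpt).exists_isMaxOn (hne.prod hne)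
    (f := fun z : Es 2 × Es 2 => ‖z.1 - z.2‖) (by fun_prop)
  have hdiam : ∀ x ∈ K, ∀ y ∈ K, ‖x - y‖ ≤ ‖p - q‖ := fun x hx y hy =>
    isMaxOn_iff.1 hmax (x, y) (Set.mk_mem_prod hx hy)
  have hpq : p - q ≠ 0 := by
    intro hpq
    have he : (EuclideanSpace.single 0 1 : Es 2) ≠ 0 := by simp
    obtain ⟨x, hx, hxpos⟩ := exists_mem_inner_pos h0 he
    have := hdiam x hx 0 (interior_subset h0)
    rw [hpq, norm_zero, norm_le_zero_iff, sub_zero] at this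
    simp [this] at hxpos
  set w : Es 2 := J (q - p)
  have hw0 : w 0 = -((q - p) 1) := (hJ _).1
  have hw1 : w 1 = (q - p) 0 := (hJ _).2
  have hw : w ≠ 0 := by
    intro hw
    refine hpq ?_
    rw [hw] at hw0 hw1
    rw [← neg_sub, neg_eq_zero]
    ext i
    fin_cases i
    · exact hw1.symm
    · exact neg_eq_zero.1 hw0.symm
  have hcont : ContinuousOn (fun x : Es 2 => ⟪x, w⟫) K := by fun_prop
  obtain ⟨r, hr, hrmax⟩ := hKcpt.exists_isMaxOn hne hcont
  obtain ⟨s, hs, hsmin⟩ := hKcpt.exists_isMinOn hne hcont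
  rw [isMaxOn_iff] at hrmax
  rw [isMinOn_iff] at hsmin
  have hdet : ∀ x : Es 2, (q - p) 0 * x 1 - (q - p) 1 * x 0 = ⟪x, w⟫ := fun x => by
    rw [hinner, hw0, hw1]
    ring
  have hqw : ⟪q, w⟫ = ⟪p, w⟫ := by
    rw [← sub_eq_zero, ← inner_sub_left, ← hdet]
    ring
  have harea := le_two_mul_volume_of_mem K hconv hKcpt w hw hp hq hr hs hqw (hrmax p hp) (hsmin p hp)
    hdet
  have hpmax : ∀ x ∈ K, ⟪x, p - q⟫ ≤ ⟪p, p - q⟫ := fun x hx =>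
    inner_le_of_norm_sub_le (hdiam x hx q hq)
  have hqmin : ∀ x ∈ K, ⟪q, p - q⟫ ≤ ⟪x, p - q⟫ := fun x hx => by
    have := inner_le_of_norm_sub_le (p := q) (q := p) (norm_sub_rev p q ▸ hdiam x hx p hp)
    rw [← neg_sub, inner_neg_right, inner_neg_right] at this
    linarith
  obtain ⟨x₁, hx₁, hx₁pos⟩ := exists_mem_inner_pos h0 hpq
  obtain ⟨x₂, hx₂, hx₂neg⟩ := exists_mem_inner_neg h0 hpq
  obtain ⟨x₃, hx₃, hx₃pos⟩ := exists_mem_inner_pos h0 hw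
  obtain ⟨x₄, hx₄, hx₄neg⟩ := exists_mem_inner_neg h0 hw
  obtain ⟨β₁, β, hβ₁, hβ, hβ₁u, hβ0, hA, hA'⟩ := exists_balanced_weights nv h hpos (p - q) q p
    (fun x hx => hqmin x ((hmemK x).2 hx)) (fun x hx => hpmax x ((hmemK x).2 hx))
    ((hmemK p).1 hp) ((hqmin _ hx₂).trans_lt hx₂neg) (hx₁pos.trans_le (hpmax _ hx₁))
  obtain ⟨γ₁, γ, hγ₁, hγ, hγ₁u, hγ0, hB, hB'⟩ := exists_balanced_weights nv h hpos w s r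
    (fun x hx => hsmin x ((hmemK x).2 hx)) (fun x hx => hrmax x ((hmemK x).2 hx))
    ((hmemK r).1 hr) (lt_of_le_of_lt (hsmin _ hx₄) hx₄neg) (lt_of_lt_of_le hx₃pos (hrmax _ hx₃))
  obtain ⟨S, T, hST⟩ := exists_finset_sum_mul_le β₁ β γ₁ γ (fun i j => ⟪nv i, J (nv j)⟫)
    hβ₁ hβ hγ₁ hγ
  have hval : ∑ i, ∑ j, β₁ i * γ₁ j * ⟪nv i, J (nv j)⟫ = ⟪p - q, p - q⟫ := by
    have hJw : J w = p - q := by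
      ext i
      fin_cases i
      · simp [hJ, hw1]
      · simp [hJ, hw0]
    have hsum : ⟪p - q, p - q⟫ = ⟪∑ i, β₁ i • nv i, J (∑ i, γ₁ i • nv i)⟫ := by
      rw [hβ₁u, hγ₁u, hJw]
    rw [hsum, map_sum, sum_inner]
    refine Finset.sum_congr rfl fun i _ => ?_
    rw [inner_sum]
    refine Finset.sum_congr rfl fun j _ => ?_
    rw [map_smul, real_inner_smul_left, real_inner_smul_right, mul_assoc]
  rw [hval] at hST
  have hD : 0 < ⟪p - q, p - q⟫ := real_inner_self_pos.2 hpq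
  have hcap := combCap_dbl_le nv (fun i => J (nv i)) h h β γ (fun i => (hβ₁ i).trans (hβ i))
    (fun i => (hγ₁ i).trans (hγ i)) hβ0
    (by simpa only [map_sum, map_smul, map_zero] using congrArg J hγ0) hA hB S T
    (hD.trans_le hST)
  have hrhs : Real.sqrt 2 * Real.sqrt ((Nat.factorial 2 : ℝ) *
      (MeasureTheory.volume (K ×ˢ (⇑J '' K))).toReal) =
        2 * (MeasureTheory.volume K).toReal := by
    rw [volume_prod_image_rotation J hJ, ENNReal.toReal_mul, ← Real.sqrt_mul (by norm_num),
      ← Real.sqrt_sq (by positivity : 0 ≤ 2 * (MeasureTheory.volume K).toReal)]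
    congr 1
    norm_num [Nat.factorial]
    ring
  rw [hrhs]
  refine hcap.trans (le_trans ?_ harea)
  rw [div_le_iff₀ (hD.trans_le hST)]
  calc _ ≤ ⟪p - q, p - q⟫ * ⟪r - s, w⟫ := mul_le_mul hA' hB' hB.le hD.le
    _ ≤ _ := by
      rw [mul_comm]
      exact mul_le_mul_of_nonneg_left hST (hB.le.trans hB')
end
end

section
/- Let K ⊂ ℝ^{2n} be a convex polytope with facet unit outer normals n_1,…,n_N and support heights h_i = sup_{y∈K} ⟨y, n_i⟩, admitting at least one admissible weight vector (β_i ≥ 0 not all zero with Σ β_i h_i = 1, Σ β_i n_i = 0), and let c(K ×_L K) denote the Haim–Kislev combinatorial quantity of the doubled facet data ñ_i = (n_i,0), ñ_{N+i} = (0,n_i), h̃_i = h̃_{N+i} = h_i in (ℝ^{2n}×ℝ^{2n}, ω̃). Then for every point x ∈ K one has c(K ×_L K) ≤ 2 Σ_{i=1}^N (h_i − ⟨x, n_i⟩)²; consequently c(K ×_L K) ≤ 2 · min_{x∈K} Σ_{i=1}^N dist(x, F_i)², where dist(x, F_i) is the Euclidean distance from x to the hyperplane {y : ⟨y, n_i⟩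 = h_i} containing the facet F_i. -/
open scoped RealInnerProductSpace BigOperators

noncomputable section

/-- The block enumeration of `Fin (2 * N)` used by `dbl`. -/
def blockEquiv (N : ℕ) : Fin N ⊕ Fin N ≃ Fin (2 * N) :=
  finSumFinEquiv.trans (finCongr (two_mul N).symm)

theorem dbl_blockEquiv_inl {N : ℕ} {α : Sort _} (f g : Fin N → α) (i : Fin N) :
    dbl f g (blockEquiv N (Sum.inl i)) = f i := by
  simp [dbl, blockEquiv]

theorem dbl_blockEquiv_inr {N : ℕ} {α : Sort _} (f g : Fin N → α) (i : Fin N) :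
    dbl f g (blockEquiv N (Sum.inr i)) = g i := by
  simp [dbl, blockEquiv]

/-- The map placing the first copy of `Fin N` at even and the second at odd positions. -/
def interleave (N : ℕ) : Fin N ⊕ Fin N → Fin (2 * N) :=
  Sum.elim (fun i => ⟨2 * i, by omega⟩) (fun i => ⟨2 * i + 1, by omega⟩)

theorem interleave_bijective (N : ℕ) : Function.Bijective (interleave N) := by
  rw [Fintype.bijective_iff_injective_and_card]
  refine ⟨?_, by simp [two_mul]⟩
  rintro (i | i) (j | j) hij <;> simp [interleave, Fin.ext_iff] at hij ⊢ <;> omega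

/-- The alternating order `0, N, 1, N + 1, …` on the doubled index set. -/
def alternatingPerm (N : ℕ) : Equiv.Perm (Fin (2 * N)) :=
  (Equiv.ofBijective _ (interleave_bijective N)).symm.trans (blockEquiv N)

theorem alternatingPerm_interleave {N : ℕ} (s : Fin N ⊕ Fin N) :
    alternatingPerm N (interleave N s) = blockEquiv N s := by
  simp [alternatingPerm, Equiv.ofBijective_symm_apply_apply]

theorem sum_dbl {N : ℕ} {M : Type*} [AddCommMonoid M] (F : Fin (2 * N) → M) :
    ∑ k, F k = ∑ i, F (blockEquiv N (Sum.inl i)) + ∑ i, F (blockEquiv N (Sum.inr i)) := by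
  rw [← (blockEquiv N).sum_comp, Fintype.sum_sum_type]

/-- Reindexing of the ordered pair sum along the alternating order. -/
theorem sum_sum_Iio_alternatingPerm {N : ℕ} (F : Fin (2 * N) → Fin (2 * N) → ℝ) :
    ∑ i, ∑ j ∈ Finset.Iio i, F (alternatingPerm N i) (alternatingPerm N j) =
      ∑ s, ∑ t, if interleave N t < interleave N s then
        F (blockEquiv N s) (blockEquiv N t) else 0 := by
  rw [← (Equiv.ofBijective _ (interleave_bijective N)).sum_comp]
  refine Finset.sum_congr rfl fun s _ => ?_
  simp only [Equiv.ofBijective_apply, alternatingPerm_interleave]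
  rw [← Finset.filter_gt_eq_Iio, Finset.sum_filter,
    ← (Equiv.ofBijective _ (interleave_bijective N)).sum_comp]
  simp only [Equiv.ofBijective_apply, alternatingPerm_interleave]

/-- The quadratic form of the doubled data, with equal weights on both copies and the
alternating order, is the sum of the squared weights. -/
theorem alternatingPerm_form_eq {m N : ℕ} (v : Fin N → Es m) (hv : ∀ i, ‖v i‖ = 1)
    (b : Fin N → ℝ) :
    ∑ i, ∑ j ∈ Finset.Iio i, dbl b b (alternatingPerm N i) * dbl b b (alternatingPerm N j) *
      omegaT
        (dbl (fun i => (v i, (0 : Es m))) (fun i => ((0 : Es m), v i)) (alternatingPerm N j))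
        (dbl (fun i => (v i, (0 : Es m))) (fun i => ((0 : Es m), v i)) (alternatingPerm N i)) =
      ∑ i, b i ^ 2 := by
  rw [sum_sum_Iio_alternatingPerm (fun p q => dbl b b p * dbl b b q * omegaT
    (dbl (fun i => (v i, (0 : Es m))) (fun i => ((0 : Es m), v i)) q)
    (dbl (fun i => (v i, (0 : Es m))) (fun i => ((0 : Es m), v i)) p))]
  simp only [Fintype.sum_sum_type, dbl_blockEquiv_inl, dbl_blockEquiv_inr, omegaT,
    inner_zero_left, inner_zero_right, sub_zero, zero_sub, neg_zero, mul_zero, ite_self,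
    Finset.sum_const_zero, zero_add, add_zero]
  rw [← Finset.sum_add_distrib]
  refine Finset.sum_congr rfl fun i _ => ?_
  rw [← Finset.sum_add_distrib, Finset.sum_eq_single i]
  · simp [interleave, hv, sq]
  · intro j _ hji
    have hne : (j : ℕ) ≠ i := fun e => hji (Fin.ext e)
    simp only [interleave, Sum.elim_inl, Sum.elim_inr, Fin.mk_lt_mk]
    rcases lt_or_gt_of_ne hne with hlt | hlt
    · rw [if_pos (by omega), if_pos (by omega), real_inner_comm]
      ring
    · rw [if_neg (by omega), if_neg (by omega), add_zero]
  · simp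

/-- Any value of the quadratic form bounds the combinatorial capacity from above. -/
theorem combCap_le_of_mem {V : Type*} [AddCommGroup V] [Module ℝ V] {L : ℕ}
    (ω : V → V → ℝ) (m : Fin L → V) (g : Fin L → ℝ) (β : Fin L → ℝ)
    (σ : Equiv.Perm (Fin L)) (hβ : ∀ i, 0 ≤ β i) (hg : ∑ i, β i * g i = 1)
    (hm : ∑ i, β i • m i = 0) {Q : ℝ} (hQ : 0 < Q)
    (hQeq : Q = ∑ i, ∑ j ∈ Finset.Iio i, β (σ i) * β (σ j) * ω (m (σ j)) (m (σ i))) :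
    combCap ω m g ≤ 1 / 2 * Q⁻¹ := by
  unfold combCap
  set S := {Q : ℝ | ∃ (β : Fin L → ℝ) (σ : Equiv.Perm (Fin L)),
      (∀ i, 0 ≤ β i) ∧ ∑ i, β i * g i = 1 ∧ ∑ i, β i • m i = 0 ∧
      0 < Q ∧ Q = ∑ i, ∑ j ∈ Finset.Iio i, β (σ i) * β (σ j) * ω (m (σ j)) (m (σ i))}
  have hmem : Q ∈ S := ⟨β, σ, hβ, hg, hm, hQ, hQeq⟩
  refine mul_le_mul_of_nonneg_left ?_ (by norm_num)
  by_cases hS : BddAbove S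
  · exact inv_anti₀ hQ (le_csSup hS hmem)
  · rw [Real.sSup_of_not_bddAbove hS, inv_zero]
    exact (inv_pos.mpr hQ).le

/-- The capacity bound for heights measured from an arbitrary base point. -/
theorem combCap_dbl_le_s9 {m N : ℕ} (v : Fin N → Es m) (hv : ∀ i, ‖v i‖ = 1)
    (h β : Fin N → ℝ) (hβ : ∀ i, 0 ≤ β i) (hsum : ∑ i, β i * h i = 1)
    (hzero : ∑ i, β i • v i = 0) (x : Es m) :
    combCap omegaT (dbl (fun i => (v i, (0 : Es m))) (fun i => ((0 : Es m), v i))) (dbl h h)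
      ≤ 2 * ∑ i, (h i - ⟪x, v i⟫) ^ 2 := by
  have hshift : ∑ i, β i * (h i - ⟪x, v i⟫) = 1 := by
    have hinner : ∑ i, β i * ⟪x, v i⟫ = 0 := by
      simpa [inner_sum, real_inner_smul_right] using congrArg (fun y => ⟪x, y⟫) hzero
    simp [mul_sub, hsum, hinner]
  have hcs : 1 ≤ (∑ i, β i ^ 2) * ∑ i, (h i - ⟪x, v i⟫) ^ 2 := by
    simpa [hshift] using
      Finset.sum_mul_sq_le_sq_mul_sq Finset.univ β (fun i => h i - ⟪x, v i⟫)
  have hpos : 0 < ∑ i, β i ^ 2 := by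
    refine (Finset.sum_nonneg fun i _ => sq_nonneg (β i)).lt_of_ne fun h0 => ?_
    rw [← h0, zero_mul] at hcs
    linarith
  set b : Fin N → ℝ := fun i => β i / 2 with hb
  have hbsq : ∑ i, b i ^ 2 = (∑ i, β i ^ 2) / 4 := by
    rw [Finset.sum_div]
    exact Finset.sum_congr rfl fun i _ => by rw [hb]; ring
  have hbzero : ∑ i, b i • v i = 0 := by
    have : ∀ i, b i • v i = (2⁻¹ : ℝ) • (β i • v i) := fun i => by
      rw [smul_smul, hb]; congr 1; ring
    simp only [this, ← Finset.smul_sum, hzero, smul_zero]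
  have hbh : ∑ i, b i * h i = 1 / 2 := by
    rw [← hsum, Finset.sum_div]
    exact Finset.sum_congr rfl fun i _ => by rw [hb]; ring
  refine (combCap_le_of_mem _ _ _ (dbl b b) (alternatingPerm N) ?_ ?_ ?_
    (Q := ∑ i, b i ^ 2) ?_ (alternatingPerm_form_eq v hv b).symm).trans ?_
  · intro k
    unfold dbl
    split_ifs <;> exact div_nonneg (hβ _) (by norm_num)
  · simp only [sum_dbl, dbl_blockEquiv_inl, dbl_blockEquiv_inr, hbh]
    norm_num
  · simp only [sum_dbl, dbl_blockEquiv_inl, dbl_blockEquiv_inr]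
    ext1 <;> simp [Prod.fst_sum, Prod.snd_sum, hbzero]
  · rw [hbsq]
    positivity
  · rw [hbsq, inv_div]
    have hle : 1 / (∑ i, β i ^ 2) ≤ ∑ i, (h i - ⟪x, v i⟫) ^ 2 := by
      rw [div_le_iff₀ hpos, mul_comm]
      exact hcs
    calc 1 / 2 * (4 / ∑ i, β i ^ 2) = 2 * (1 / ∑ i, β i ^ 2) := by ring
      _ ≤ _ := by gcongr

theorem sub_inner_le_infDist_hyperplane {m : ℕ} (x v : Es m) (hv : ‖v‖ = 1) (c : ℝ) :
    c - ⟪x, v⟫ ≤ Metric.infDist x {y : Es m | ⟪y, v⟫ = c} := by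
  refine (Metric.le_infDist ⟨c • v, by simp [real_inner_smul_left, hv]⟩).2 fun y hy => ?_
  rw [← show ⟪y, v⟫ = c from hy, ← inner_sub_left, dist_comm, dist_eq_norm]
  simpa [hv] using real_inner_le_norm (y - x) v

theorem cap_prod_KK_le_two_min_dist_sq (n N : ℕ) (hn : 1 ≤ n)
    (nv : Fin N → Es (2 * n)) (hunit : ∀ i, ‖nv i‖ = 1)
    (h : Fin N → ℝ)
    (K : Set (Es (2 * n)))
    (hK : K = {x | ∀ i, ⟪x, nv i⟫ ≤ h i})
    (hKcpt : IsCompact K) (hne : K.Nonempty)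
    (hsup : ∀ i, h i = sSup ((fun y => ⟪y, nv i⟫) '' K))
    (hadm : ∃ β : Fin N → ℝ, (∀ i, 0 ≤ β i) ∧ (∃ i, β i ≠ 0) ∧
      ∑ i, β i * h i = 1 ∧ ∑ i, β i • nv i = 0) :
    (∀ x ∈ K,
      combCap omegaT
          (dbl (fun i => (nv i, (0 : Es (2 * n)))) (fun i => ((0 : Es (2 * n)), nv i)))
          (dbl h h)
        ≤ 2 * ∑ i, (h i - ⟪x, nv i⟫) ^ 2) ∧
    combCap omegaT
        (dbl (fun i => (nv i, (0 : Es (2 * n)))) (fun i => ((0 : Es (2 * n)), nv i)))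
        (dbl h h)
      ≤ 2 * sInf ((fun x => ∑ i, (Metric.infDist x {y : Es (2 * n) | ⟪y, nv i⟫ = h i}) ^ 2) '' K) := by
  obtain ⟨β, hβ, -, hsum, hzero⟩ := hadm
  have hbound := combCap_dbl_le_s9 nv hunit h β hβ hsum hzero
  refine ⟨fun x _ => hbound x, ?_⟩
  rw [← div_le_iff₀' two_pos]
  refine le_csInf (hne.image _) ?_
  rintro _ ⟨x, hx, rfl⟩
  rw [div_le_iff₀' two_pos]
  refine (hbound x).trans ?_
  rw [hK] at hx
  exact mul_le_mul_of_nonneg_left (Finset.sum_le_sum fun i _ => pow_le_pow_left₀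
    (sub_nonneg.mpr (hx i))
    (sub_inner_le_infDist_hyperplane x (nv i) (hunit i) (h i)) 2) two_pos.le
end
end
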